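/- Assume the Lr (a,τ) interval exchange transformation T has no periodic points (no x ∈ [0,1) and k ≥ 1 with T^k x = x). If x, y are distinct points of [0,1), then the pair 𝓘(x), 𝓘(y) is neither positively nor negatively asymptotic; and if x, y are distinct points of (0,1], then the pair 𝓘̃(x), 𝓘̃(y) is neither positively nor negatively asymptotic. -/

import Mathlib

open Set

noncomputable section

/-- `bpt a k = a_1 + ⋯ + a_k` (0-indexed: the sum of the first `k` entries of `a`);
these are the division points `b_k` of the interval exchange. -/
def bpt {n : ℕ} (a : Fin n → ℝ) (k : ℕ) : ℝ :=
  ∑ j ∈ Finset.univ.filter (fun j : Fin n => (j : ℕ) < k), a j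

/-- The left-closed right-open interval `J_i = [b_{i-1}, b_i)` (0-indexed). -/
def Jint {n : ℕ} (a : Fin n → ℝ) (i : Fin n) : Set ℝ :=
  Set.Ico (bpt a (i : ℕ)) (bpt a ((i : ℕ) + 1))

/-- The left-open right-closed interval `J̃_i = (b_{i-1}, b_i]` (0-indexed). -/
def Jtil {n : ℕ} (a : Fin n → ℝ) (i : Fin n) : Set ℝ :=
  Set.Ioc (bpt a (i : ℕ)) (bpt a ((i : ℕ) + 1))

/-- The permuted probability vector `a^τ`, with `a^τ_{τ(i)} = a_i`. -/
def aperm {n : ℕ} (a : Fin n → ℝ) (τ : Equiv.Perm (Fin n)) : Fin n → ℝ :=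
  fun j => a (τ.symm j)

/-- The set `D = {b_1, …, b_{n-1}}` of interior division points. -/
def Dset {n : ℕ} (a : Fin n → ℝ) : Set ℝ :=
  {x | ∃ k : ℕ, 0 < k ∧ k < n ∧ x = bpt a k}

/-- `a` is a positive probability vector. -/
def IsProbVec {n : ℕ} (a : Fin n → ℝ) : Prop :=
  (∀ i, 0 < a i) ∧ ∑ i, a i = 1

/-- `T` is the Lr `(a,τ)` interval exchange transformation: on each
`J_i = [b_{i-1}, b_i)` it is the translation `x ↦ x - b_{i-1} + b^τ_{τ(i)-1}`. -/
def IsLrIET {n : ℕ} (a : Fin n → ℝ) (τ : Equiv.Perm (Fin n)) (T : ℝ → ℝ) : Prop :=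
  ∀ i : Fin n, ∀ x ∈ Jint a i, T x = x - bpt a (i : ℕ) + bpt (aperm a τ) ((τ i : ℕ))

/-- `Tt` is the dual lR `(a,τ)` interval exchange transformation: on each
`J̃_i = (b_{i-1}, b_i]` it is the translation `x ↦ x - b_{i-1} + b^τ_{τ(i)-1}`. -/
def IslRIET {n : ℕ} (a : Fin n → ℝ) (τ : Equiv.Perm (Fin n)) (Tt : ℝ → ℝ) : Prop :=
  ∀ i : Fin n, ∀ x ∈ Jtil a i, Tt x = x - bpt a (i : ℕ) + bpt (aperm a τ) ((τ i : ℕ))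

/-- The Keane Condition: `D ∩ T^k(D) = ∅` for every positive integer `k`. -/
def KeaneCond {n : ℕ} (a : Fin n → ℝ) (T : ℝ → ℝ) : Prop :=
  ∀ k : ℕ, 0 < k → Dset a ∩ (T^[k] '' Dset a) = ∅

/-- `τ` is irreducible: `τ({1,…,j}) ≠ {1,…,j}` for `j = 1, …, n-1` (0-indexed:
no proper initial segment is invariant). -/
def IrreduciblePerm {n : ℕ} (τ : Equiv.Perm (Fin n)) : Prop :=
  ∀ j : ℕ, 0 < j → j < n →
    (fun i => τ i) '' {i : Fin n | (i : ℕ) < j} ≠ {i : Fin n | (i : ℕ) < j}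

/-- `P` is the family of ℤ-iterates of `T` on `[0,1)`: `P 0 = id`,
`P (k+1) = T ∘ P k`, and each `P k` maps `[0,1)` into itself. -/
def IsZIterLr (T : ℝ → ℝ) (P : ℤ → ℝ → ℝ) : Prop :=
  (∀ x ∈ Set.Ico (0 : ℝ) 1, P 0 x = x) ∧
  ∀ k : ℤ, ∀ x ∈ Set.Ico (0 : ℝ) 1, P k x ∈ Set.Ico (0 : ℝ) 1 ∧ P (k + 1) x = T (P k x)

/-- `Pt` is the family of ℤ-iterates of `Tt` on `(0,1]`. -/
def IsZIterlR (Tt : ℝ → ℝ) (Pt : ℤ → ℝ → ℝ) : Prop :=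
  (∀ x ∈ Set.Ioc (0 : ℝ) 1, Pt 0 x = x) ∧
  ∀ k : ℤ, ∀ x ∈ Set.Ioc (0 : ℝ) 1, Pt k x ∈ Set.Ioc (0 : ℝ) 1 ∧ Pt (k + 1) x = Tt (Pt k x)

/-- `I` is the itinerary map of `T` (with ℤ-iterates `P`):
`𝓘(x)_k = i ↔ T^k x ∈ J_i` for `x ∈ [0,1)`. -/
def IsItin {n : ℕ} (a : Fin n → ℝ) (P : ℤ → ℝ → ℝ) (I : ℝ → ℤ → Fin n) : Prop :=
  ∀ x ∈ Set.Ico (0 : ℝ) 1, ∀ k : ℤ, ∀ i : Fin n, (I x k = i ↔ P k x ∈ Jint a i)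

/-- `It` is the itinerary map of `Tt` (with ℤ-iterates `Pt`):
`𝓘̃(x)_k = i ↔ T̃^k x ∈ J̃_i` for `x ∈ (0,1]`. -/
def IsItinDual {n : ℕ} (a : Fin n → ℝ) (Pt : ℤ → ℝ → ℝ) (It : ℝ → ℤ → Fin n) : Prop :=
  ∀ x ∈ Set.Ioc (0 : ℝ) 1, ∀ k : ℤ, ∀ i : Fin n, (It x k = i ↔ Pt k x ∈ Jtil a i)

/-- `D_∞ = {0,1} ∪ ⋃_{k ∈ ℤ} T^k(D)`. -/
def Dinf {n : ℕ} (a : Fin n → ℝ) (P : ℤ → ℝ → ℝ) : Set ℝ :=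
  {0, 1} ∪ ⋃ k : ℤ, P k '' Dset a

/-- The set `R = [0,1] ∖ D_∞` of regular points. -/
def Rset {n : ℕ} (a : Fin n → ℝ) (P : ℤ → ℝ → ℝ) : Set ℝ :=
  Set.Icc 0 1 \ Dinf a P

/-- The shift `S` on `Ω = {1,…,n}^ℤ`: `S(α)_i = α_{i+1}`. -/
def shiftS {n : ℕ} (α : ℤ → Fin n) : ℤ → Fin n := fun i => α (i + 1)

/-- The `k`-th power of the shift: `(S^k α)_i = α_{i+k}`. -/
def shiftZ {n : ℕ} (k : ℤ) (α : ℤ → Fin n) : ℤ → Fin n := fun i => α (i + k)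

/-- `α, β` are positively asymptotic: `α_i = β_i` for all `i ≥ N`, some `N`. -/
def PosAsymp {n : ℕ} (α β : ℤ → Fin n) : Prop :=
  ∃ N : ℕ, ∀ i : ℤ, (N : ℤ) ≤ i → α i = β i

/-- `α, β` are negatively asymptotic: `α_i = β_i` for all `i ≤ -N`, some `N`. -/
def NegAsymp {n : ℕ} (α β : ℤ → Fin n) : Prop :=
  ∃ N : ℕ, ∀ i : ℤ, i ≤ -(N : ℤ) → α i = β i

/-- A bounded real sequence has two terms that are closer than a given positive distance. -/
theorem exists_lt_abs_sub_lt (s : ℕ → ℝ) (hs : ∀ k, s k ∈ Icc (0 : ℝ) 1) {δ : ℝ} (hδ : 0 < δ) :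
    ∃ i j, i < j ∧ |s i - s j| < δ := by
  have hmaps : MapsTo (fun k => ⌊s k / δ⌋) univ (Icc 0 ⌊1 / δ⌋) := fun k _ =>
    ⟨Int.floor_nonneg.2 (div_nonneg (hs k).1 hδ.le),
      Int.floor_le_floor (div_le_div_of_nonneg_right (hs k).2 hδ.le)⟩
  obtain ⟨i, -, j, -, hne, h⟩ :=
    infinite_univ.exists_ne_map_eq_of_mapsTo hmaps (finite_Icc _ _)
  have hij : |s i - s j| < δ := by
    have := Int.abs_sub_lt_one_of_floor_eq_floor h
    rwa [← sub_div, abs_div, abs_of_pos hδ, div_lt_one hδ] at this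
  rcases lt_or_gt_of_ne hne with hlt | hlt
  · exact ⟨i, j, hlt, hij⟩
  · exact ⟨j, i, hlt, by rwa [abs_sub_comm]⟩

/-- `x` and `y` have a common forward itinerary under `F` with respect to the sets `J i`. -/
def SameForward {ι : Type*} (F : ℝ → ℝ) (J : ι → Set ℝ) (x y : ℝ) : Prop :=
  ∀ k : ℕ, ∃ i, F^[k] x ∈ J i ∧ F^[k] y ∈ J i

section PiecewiseTranslation

variable {ι : Type*} {F : ℝ → ℝ} {J : ι → Set ℝ} {c : ι → ℝ} {X : Set ℝ} {x y z : ℝ}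

theorem SameForward.iterate (h : SameForward F J x y) (m : ℕ) :
    SameForward F J (F^[m] x) (F^[m] y) := fun k => by
  simpa only [Function.iterate_add_apply] using h (k + m)

theorem SameForward.iterate_sub (hF : ∀ i, ∀ x ∈ J i, F x = x + c i)
    (h : SameForward F J x y) (k : ℕ) : F^[k] y - F^[k] x = y - x := by
  induction k with
  | zero => rfl
  | succ k ih =>
    obtain ⟨i, hx, hy⟩ := h k
    rw [Function.iterate_succ_apply', Function.iterate_succ_apply', hF i _ hx, hF i _ hy]
    linarith

theorem SameForward.iterate_of_mem_Icc (hF : ∀ i, ∀ x ∈ J i, F x = x + c i)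
    (hJ : ∀ i, (J i).OrdConnected) (h : SameForward F J x y) (hz : z ∈ Icc x y) (k : ℕ) :
    F^[k] z = F^[k] x + (z - x) := by
  induction k with
  | zero => simp
  | succ k ih =>
    obtain ⟨i, hx, hy⟩ := h k
    have hd := h.iterate_sub hF k
    have hzi : F^[k] z ∈ J i :=
      (hJ i).out hx hy ⟨by linarith [hz.1], by linarith [hz.2]⟩
    rw [Function.iterate_succ_apply', Function.iterate_succ_apply', hF i _ hx, hF i _ hzi]
    linarith

theorem SameForward.of_mem_Icc (hF : ∀ i, ∀ x ∈ J i, F x = x + c i)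
    (hJ : ∀ i, (J i).OrdConnected) (h : SameForward F J x y) (hz : z ∈ Icc x y) :
    SameForward F J x z ∧ SameForward F J y z := by
  have key : ∀ k, ∃ i, F^[k] x ∈ J i ∧ F^[k] y ∈ J i ∧ F^[k] z ∈ J i := fun k => by
    obtain ⟨i, hx, hy⟩ := h k
    have hd := h.iterate_sub hF k
    have he := h.iterate_of_mem_Icc hF hJ hz k
    exact ⟨i, hx, hy, (hJ i).out hx hy ⟨by linarith [hz.1], by linarith [hz.2]⟩⟩
  exact ⟨fun k => (key k).imp fun i hi => ⟨hi.1, hi.2.2⟩,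
    fun k => (key k).imp fun i hi => ⟨hi.2.1, hi.2.2⟩⟩

/-- A point whose itinerary is periodic is itself periodic. -/
theorem SameForward.iterate_eq_self (hF : ∀ i, ∀ x ∈ J i, F x = x + c i)
    (hX : X ⊆ Icc 0 1) (hFX : MapsTo F X X) (hx : x ∈ X) {m : ℕ}
    (h : SameForward F J x (F^[m] x)) : F^[m] x = x := by
  have hlin : ∀ k : ℕ, F^[k * m] x = x + k * (F^[m] x - x) := fun k => by
    induction k with
    | zero => simp
    | succ k ih =>
      have hd := h.iterate_sub hF (k * m)
      rw [← Function.iterate_add_apply, ← Nat.succ_mul] at hd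
      push_cast
      rw [Nat.succ_eq_add_one] at hd
      linarith
  have hbd : ∀ k : ℕ, (k : ℝ) * |F^[m] x - x| ≤ 1 := fun k => by
    have h1 := hX (hFX.iterate (k * m) hx)
    have h0 := hX hx
    rw [hlin k] at h1
    have : |(k : ℝ) * (F^[m] x - x)| ≤ 1 :=
      abs_le.2 ⟨by linarith [h1.1, h0.2], by linarith [h1.2, h0.1]⟩
    rwa [abs_mul, Nat.abs_cast] at this
  by_contra hne
  have hpos : 0 < |F^[m] x - x| := abs_pos.2 (sub_ne_zero.2 hne)
  obtain ⟨k, hk⟩ := exists_nat_gt (1 / |F^[m] x - x|)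
  rw [div_lt_iff₀ hpos] at hk
  exact absurd (hbd k) (not_le.2 hk)

theorem SameForward.le (hF : ∀ i, ∀ x ∈ J i, F x = x + c i)
    (hJ : ∀ i, (J i).OrdConnected) (hX : X ⊆ Icc 0 1) (hFX : MapsTo F X X)
    (hper : ∀ x ∈ X, ∀ k : ℕ, 1 ≤ k → F^[k] x ≠ x) (hx : x ∈ X) (hy : y ∈ X)
    (h : SameForward F J x y) : y ≤ x := by
  by_contra! hlt
  obtain ⟨i, j, hij, hd⟩ := exists_lt_abs_sub_lt (fun k => F^[k] x)
    (fun k => hX (hFX.iterate k hx)) (sub_pos.2 hlt)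
  obtain ⟨m, rfl⟩ := Nat.exists_eq_add_of_lt hij
  have hm : ∀ u, F^[i + m + 1] u = F^[m + 1] (F^[i] u) := fun u => by
    rw [← Function.iterate_add_apply, show m + 1 + i = i + m + 1 by omega]
  have hi := h.iterate_sub hF i
  have hj := h.iterate_sub hF (i + m + 1)
  rw [abs_lt] at hd
  rcases le_total (F^[i] x) (F^[i + m + 1] x) with hle | hle
  · have hs := ((h.iterate i).of_mem_Icc hF hJ
      (z := F^[i + m + 1] x) ⟨hle, by linarith [hd.1]⟩).1
    rw [hm] at hs
    exact hper _ (hFX.iterate i hx) (m + 1) (by omega)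
      (hs.iterate_eq_self hF hX hFX (hFX.iterate i hx))
  · have hs := ((h.iterate i).of_mem_Icc hF hJ
      (z := F^[i + m + 1] y) ⟨by linarith [hd.2], by linarith⟩).2
    rw [hm] at hs
    exact hper _ (hFX.iterate i hy) (m + 1) (by omega)
      (hs.iterate_eq_self hF hX hFX (hFX.iterate i hy))

/-- For an aperiodic piecewise translation, the forward itinerary determines the point. -/
theorem SameForward.eq (hF : ∀ i, ∀ x ∈ J i, F x = x + c i)
    (hJ : ∀ i, (J i).OrdConnected) (hX : X ⊆ Icc 0 1) (hFX : MapsTo F X X)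
    (hper : ∀ x ∈ X, ∀ k : ℕ, 1 ≤ k → F^[k] x ≠ x) (hx : x ∈ X) (hy : y ∈ X)
    (h : SameForward F J x y) : x = y := by
  have h' : SameForward F J y x := fun k => (h k).imp fun _ hi => hi.symm
  exact le_antisymm (h'.le hF hJ hX hFX hper hy hx) (h.le hF hJ hX hFX hper hx hy)

end PiecewiseTranslation

section IntegerIterates

variable {n : ℕ} {F : ℝ → ℝ} {J : Fin n → Set ℝ} {c : Fin n → ℝ} {X : Set ℝ} {x y : ℝ}
  {P : ℤ → ℝ → ℝ} {I : ℝ → ℤ → Fin n}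

theorem iterate_zIter (hP : ∀ k : ℤ, ∀ x ∈ X, P k x ∈ X ∧ P (k + 1) x = F (P k x))
    (hx : x ∈ X) (m : ℤ) (k : ℕ) : F^[k] (P m x) = P (m + k) x := by
  induction k with
  | zero => simp
  | succ k ih =>
    rw [Function.iterate_succ_apply', ih, ← (hP _ x hx).2]
    push_cast
    rw [add_assoc]

theorem mapsTo_of_zIter (hP0 : ∀ x ∈ X, P 0 x = x)
    (hP : ∀ k : ℤ, ∀ x ∈ X, P k x ∈ X ∧ P (k + 1) x = F (P k x)) : MapsTo F X X := fun x hx => by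
  have h := (hP 0 x hx).2
  rw [hP0 x hx] at h
  exact h ▸ (hP _ x hx).1

theorem zIter_neg_one_zIter (hinj : InjOn F X) (hP0 : ∀ x ∈ X, P 0 x = x)
    (hP : ∀ k : ℤ, ∀ x ∈ X, P k x ∈ X ∧ P (k + 1) x = F (P k x)) (hx : x ∈ X) (m : ℤ) :
    P (-1) (P m x) = P (m - 1) x := by
  have hm := (hP m x hx).1
  refine hinj (hP _ _ hm).1 (hP _ x hx).1 ?_
  rw [← (hP _ _ hm).2, ← (hP _ x hx).2, neg_add_cancel, sub_add_cancel, hP0 _ hm]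

theorem iterate_zIter_neg_one (hinj : InjOn F X) (hP0 : ∀ x ∈ X, P 0 x = x)
    (hP : ∀ k : ℤ, ∀ x ∈ X, P k x ∈ X ∧ P (k + 1) x = F (P k x)) (hx : x ∈ X) (m : ℤ) (k : ℕ) :
    (P (-1))^[k] (P m x) = P (m - k) x := by
  induction k with
  | zero => simp
  | succ k ih =>
    rw [Function.iterate_succ_apply', ih, zIter_neg_one_zIter hinj hP0 hP hx]
    push_cast
    rw [sub_sub]

theorem not_posAsymp_of_aperiodic (hF : ∀ i, ∀ x ∈ J i, F x = x + c i)
    (hJ : ∀ i, (J i).OrdConnected) (hX : X ⊆ Icc 0 1) (hinj : InjOn F X)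
    (hP0 : ∀ x ∈ X, P 0 x = x)
    (hP : ∀ k : ℤ, ∀ x ∈ X, P k x ∈ X ∧ P (k + 1) x = F (P k x))
    (hI : ∀ x ∈ X, ∀ k : ℤ, ∀ i : Fin n, (I x k = i ↔ P k x ∈ J i))
    (hper : ∀ x ∈ X, ∀ k : ℕ, 1 ≤ k → F^[k] x ≠ x)
    (hx : x ∈ X) (hy : y ∈ X) (hxy : x ≠ y) : ¬ PosAsymp (I x) (I y) := by
  rintro ⟨N, hN⟩
  have hFX : MapsTo F X X := mapsTo_of_zIter hP0 hP
  have hs : SameForward F J (P N x) (P N y) := fun k => by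
    refine ⟨I x (N + k), ?_, ?_⟩
    · rw [iterate_zIter hP hx]
      exact (hI x hx _ _).1 rfl
    · rw [iterate_zIter hP hy]
      exact (hI y hy _ _).1 (hN _ (by omega)).symm
  have he := hs.eq hF hJ hX hFX hper (hP N x hx).1 (hP N y hy).1
  refine hxy (hinj.iterate hFX N hx hy ?_)
  have h1 := iterate_zIter hP hx 0 N
  have h2 := iterate_zIter hP hy 0 N
  rw [hP0 _ hx, zero_add] at h1
  rw [hP0 _ hy, zero_add] at h2
  rw [h1, h2, he]

theorem not_negAsymp_of_aperiodic (hF : ∀ i, ∀ x ∈ J i, F x = x + c i)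
    (hJ : ∀ i, (J i).OrdConnected) (hJX : ∀ i, J i ⊆ X) (hX : X ⊆ Icc 0 1) (hinj : InjOn F X)
    (hP0 : ∀ x ∈ X, P 0 x = x)
    (hP : ∀ k : ℤ, ∀ x ∈ X, P k x ∈ X ∧ P (k + 1) x = F (P k x))
    (hI : ∀ x ∈ X, ∀ k : ℤ, ∀ i : Fin n, (I x k = i ↔ P k x ∈ J i))
    (hper : ∀ x ∈ X, ∀ k : ℕ, 1 ≤ k → F^[k] x ≠ x)
    (hx : x ∈ X) (hy : y ∈ X) (hxy : x ≠ y) : ¬ NegAsymp (I x) (I y) := by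
  rintro ⟨N, hN⟩
  have hcancel : ∀ z ∈ X, F (P (-1) z) = z := fun z hz => by
    rw [← (hP _ z hz).2, neg_add_cancel, hP0 z hz]
  have hG : ∀ i, ∀ z ∈ {z | z - c i ∈ J i}, P (-1) z = z + -c i := fun i z hz => by
    have hFz : F (z - c i) = z := by rw [hF i _ hz, sub_add_cancel]
    have hzX : z ∈ X := hFz ▸ mapsTo_of_zIter hP0 hP (hJX i hz)
    rw [← sub_eq_add_neg]
    exact hinj (hP _ z hzX).1 (hJX i hz) (by rw [hcancel z hzX, hFz])
  have hGJ : ∀ i, {z | z - c i ∈ J i}.OrdConnected := fun i =>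
    ⟨fun u hu v hv w hw => (hJ i).out hu hv
      ⟨sub_le_sub_right hw.1 _, sub_le_sub_right hw.2 _⟩⟩
  have hGper : ∀ z ∈ X, ∀ k : ℕ, 1 ≤ k → (P (-1))^[k] z ≠ z := fun z hz k hk h => by
    have h1 := iterate_zIter_neg_one hinj hP0 hP hz 0 k
    have h2 := iterate_zIter hP hz (0 - k) k
    rw [hP0 z hz, h] at h1
    rw [← h1, sub_add_cancel, hP0 z hz] at h2
    exact hper z hz k hk h2
  have hmem : ∀ z ∈ X, ∀ m : ℤ, P m z - c (I z (m - 1)) ∈ J (I z (m - 1)) := fun z hz m => by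
    have h := (hI z hz (m - 1) _).1 rfl
    have h1 := (hP (m - 1) z hz).2
    rw [sub_add_cancel, hF _ _ h] at h1
    rwa [h1, add_sub_cancel_right]
  have hs : SameForward (P (-1)) (fun i => {z | z - c i ∈ J i}) (P (-N) x) (P (-N) y) :=
    fun k => by
      refine ⟨I x (-N - k - 1), ?_, ?_⟩
      · rw [iterate_zIter_neg_one hinj hP0 hP hx]
        exact hmem x hx _
      · rw [iterate_zIter_neg_one hinj hP0 hP hy, hN _ (by omega)]
        exact hmem y hy _
  have he := hs.eq hG hGJ hX (fun z hz => (hP _ z hz).1) hGper (hP _ x hx).1 (hP _ y hy).1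
  have h1 := iterate_zIter hP hx (-N) N
  have h2 := iterate_zIter hP hy (-N) N
  rw [neg_add_cancel, hP0 _ hx] at h1
  rw [neg_add_cancel, hP0 _ hy] at h2
  exact hxy (by rw [← h1, ← h2, he])

end IntegerIterates

section IntervalExchange

variable {n : ℕ} {a : Fin n → ℝ} {τ : Equiv.Perm (Fin n)} {T Tt : ℝ → ℝ}

theorem bpt_zero (a : Fin n → ℝ) : bpt a 0 = 0 := by simp [bpt]

theorem bpt_self (a : Fin n → ℝ) : bpt a n = ∑ i, a i := by simp [bpt]

theorem bpt_succ (a : Fin n → ℝ) (i : Fin n) : bpt a ((i : ℕ) + 1) = bpt a i + a i := by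
  have h : Finset.univ.filter (fun j : Fin n => (j : ℕ) < (i : ℕ) + 1) =
      insert i (Finset.univ.filter (fun j : Fin n => (j : ℕ) < (i : ℕ))) := by
    ext j
    simp only [Finset.mem_filter, Finset.mem_univ, true_and, Finset.mem_insert, Fin.ext_iff]
    omega
  rw [bpt, h, Finset.sum_insert (by simp), add_comm, bpt]

theorem bpt_monotone (ha : ∀ i, 0 ≤ a i) : Monotone (bpt a) := fun _ _ hkl =>
  Finset.sum_le_sum_of_subset_of_nonneg
    (Finset.monotone_filter_right _ fun _ _ hj => lt_of_lt_of_le hj hkl) fun i _ _ => ha i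

theorem bpt_mem_Icc (ha : IsProbVec a) {k : ℕ} (hk : k ≤ n) : bpt a k ∈ Icc (0 : ℝ) 1 := by
  have hmono := bpt_monotone fun i => (ha.1 i).le
  exact ⟨bpt_zero a ▸ hmono (Nat.zero_le k), ha.2 ▸ bpt_self a ▸ hmono hk⟩

theorem Jint_subset (ha : IsProbVec a) (i : Fin n) : Jint a i ⊆ Ico 0 1 :=
  Ico_subset_Ico (bpt_mem_Icc ha i.2.le).1 (bpt_mem_Icc ha i.2).2

theorem Jtil_subset (ha : IsProbVec a) (i : Fin n) : Jtil a i ⊆ Ioc 0 1 :=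
  Ioc_subset_Ioc (bpt_mem_Icc ha i.2.le).1 (bpt_mem_Icc ha i.2).2

theorem disjoint_Jint (ha : ∀ i, 0 ≤ a i) {i j : Fin n} (h : i ≠ j) :
    Disjoint (Jint a i) (Jint a j) :=
  (bpt_monotone ha).pairwise_disjoint_on_Ico_succ (Fin.val_ne_of_ne h)

theorem disjoint_Jtil (ha : ∀ i, 0 ≤ a i) {i j : Fin n} (h : i ≠ j) :
    Disjoint (Jtil a i) (Jtil a j) :=
  (bpt_monotone ha).pairwise_disjoint_on_Ioc_succ (Fin.val_ne_of_ne h)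

theorem bpt_aperm_succ (a : Fin n → ℝ) (τ : Equiv.Perm (Fin n)) (i : Fin n) :
    bpt (aperm a τ) ((τ i : ℕ) + 1) = bpt (aperm a τ) (τ i) + a i := by
  rw [bpt_succ, aperm, Equiv.symm_apply_apply]

theorem IsLrIET.mem_Jint_aperm (hT : IsLrIET a τ T) {i : Fin n} {x : ℝ} (hx : x ∈ Jint a i) :
    T x ∈ Jint (aperm a τ) (τ i) := by
  have h := bpt_succ a i
  rw [Jint, bpt_aperm_succ, hT i x hx]
  exact ⟨by linarith [hx.1], by linarith [hx.2]⟩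

theorem IslRIET.mem_Jtil_aperm (hT : IslRIET a τ Tt) {i : Fin n} {x : ℝ} (hx : x ∈ Jtil a i) :
    Tt x ∈ Jtil (aperm a τ) (τ i) := by
  have h := bpt_succ a i
  rw [Jtil, bpt_aperm_succ, hT i x hx]
  exact ⟨by linarith [hx.1], by linarith [hx.2]⟩

theorem injOn_of_piecewise_translation {F : ℝ → ℝ} {X : Set ℝ} {J K : Fin n → Set ℝ}
    {c : Fin n → ℝ} (hF : ∀ i, ∀ x ∈ J i, F x = x + c i) (hX : ∀ x ∈ X, ∃ i, x ∈ J i)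
    (hK : ∀ i j, i ≠ j → Disjoint (K i) (K j)) (hFK : ∀ i, ∀ x ∈ J i, F x ∈ K (τ i)) :
    InjOn F X := by
  intro x hx y hy hxy
  obtain ⟨i, hi⟩ := hX x hx
  obtain ⟨j, hj⟩ := hX y hy
  obtain rfl : i = j := by
    by_contra hne
    exact disjoint_left.1 (hK _ _ (τ.injective.ne hne)) (hFK i x hi) (hxy ▸ hFK j y hj)
  rw [hF i x hi, hF i y hj] at hxy
  exact add_right_cancel hxy

/-- Just to the left of `y`, the iterates of `T` are translations given by the orbit of `y`
under the dual transformation. -/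
theorem exists_iterate_eq_dual (hT : IsLrIET a τ T) (hTt : IslRIET a τ Tt) {y : ℝ}
    (hy : ∀ k : ℕ, ∃ i, Tt^[k] y ∈ Jtil a i) (m : ℕ) :
    ∃ ε > 0, ∀ z ∈ Ioo (y - ε) y, T^[m] z = Tt^[m] y + (z - y) := by
  induction m with
  | zero => exact ⟨1, one_pos, fun z _ => by simp⟩
  | succ m ih =>
    obtain ⟨ε, hε, h⟩ := ih
    obtain ⟨i, hi⟩ := hy m
    refine ⟨min ε (Tt^[m] y - bpt a i), lt_min hε (sub_pos.2 hi.1), fun z hz => ?_⟩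
    have h1 := min_le_left ε (Tt^[m] y - bpt a i)
    have h2 := min_le_right ε (Tt^[m] y - bpt a i)
    have hz1 := hz.1
    have hz2 := hz.2
    have he := h z ⟨by linarith, hz2⟩
    have hmem : T^[m] z ∈ Jint a i := by
      rw [he]
      exact ⟨by linarith, by linarith [hi.2]⟩
    rw [Function.iterate_succ_apply', Function.iterate_succ_apply', hT i _ hmem, hTt i _ hi, he]
    ring

theorem dual_aperiodic (hT : IsLrIET a τ T) (hTt : IslRIET a τ Tt)
    (hnoper : ¬ ∃ x ∈ Ico (0 : ℝ) 1, ∃ k : ℕ, 1 ≤ k ∧ T^[k] x = x) {y : ℝ}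
    (hy01 : y ∈ Ioc (0 : ℝ) 1) (hy : ∀ k : ℕ, ∃ i, Tt^[k] y ∈ Jtil a i) {k : ℕ} (hk : 1 ≤ k) :
    Tt^[k] y ≠ y := fun h => by
  obtain ⟨ε, hε, hz⟩ := exists_iterate_eq_dual hT hTt hy k
  obtain ⟨z, hz1, hz2⟩ := exists_between (max_lt (sub_lt_self y hε) hy01.1)
  rw [max_lt_iff] at hz1
  refine hnoper ⟨z, ⟨hz1.2.le, hz2.trans_le hy01.2⟩, k, hk, ?_⟩
  rw [hz z ⟨hz1.1, hz2⟩, h]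
  ring

end IntervalExchange

/-- Theorem 4.4 (i),(ii): if `T` has no periodic points and `x ≠ y`
in `[0,1)` then `𝓘(x), 𝓘(y)` are neither positively nor negatively asymptotic;
similarly for `𝓘̃` on `(0,1]`. -/
theorem stmt12 {n : ℕ} (hn : 2 ≤ n) (a : Fin n → ℝ) (ha : IsProbVec a)
    (τ : Equiv.Perm (Fin n)) (T Tt : ℝ → ℝ)
    (hT : IsLrIET a τ T) (hTt : IslRIET a τ Tt)
    (P Pt : ℤ → ℝ → ℝ) (hP : IsZIterLr T P) (hPt : IsZIterlR Tt Pt)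
    (I It : ℝ → ℤ → Fin n) (hI : IsItin a P I) (hIt : IsItinDual a Pt It)
    (hnoper : ¬ ∃ x ∈ Set.Ico (0 : ℝ) 1, ∃ k : ℕ, 1 ≤ k ∧ T^[k] x = x) :
    (∀ x ∈ Set.Ico (0 : ℝ) 1, ∀ y ∈ Set.Ico (0 : ℝ) 1, x ≠ y →
      ¬ PosAsymp (I x) (I y) ∧ ¬ NegAsymp (I x) (I y)) ∧
    (∀ x ∈ Set.Ioc (0 : ℝ) 1, ∀ y ∈ Set.Ioc (0 : ℝ) 1, x ≠ y →
      ¬ PosAsymp (It x) (It y) ∧ ¬ NegAsymp (It x) (It y)) := by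
  have ha0 : ∀ j, 0 ≤ aperm a τ j := fun j => (ha.1 _).le
  constructor
  · have hF : ∀ i, ∀ x ∈ Jint a i, T x = x + (bpt (aperm a τ) (τ i) - bpt a i) :=
      fun i x hx => by rw [hT i x hx]; ring
    have hinj : InjOn T (Ico 0 1) := injOn_of_piecewise_translation hF
      (fun x hx => ⟨I x 0, by simpa [hP.1 x hx] using (hI x hx 0 _).1 rfl⟩)
      (fun i j h => disjoint_Jint ha0 h) (fun i x hx => hT.mem_Jint_aperm hx)
    have hper : ∀ x ∈ Ico (0 : ℝ) 1, ∀ k : ℕ, 1 ≤ k → T^[k] x ≠ x :=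
      fun x hx k hk h => hnoper ⟨x, hx, k, hk, h⟩
    have hJ : ∀ i, (Jint a i).OrdConnected := fun i => ordConnected_Ico
    exact fun x hx y hy hxy =>
      ⟨not_posAsymp_of_aperiodic hF hJ Ico_subset_Icc_self hinj hP.1 hP.2 hI hper hx hy hxy,
        not_negAsymp_of_aperiodic hF hJ (Jint_subset ha) Ico_subset_Icc_self hinj hP.1 hP.2 hI
          hper hx hy hxy⟩
  · have hF : ∀ i, ∀ x ∈ Jtil a i, Tt x = x + (bpt (aperm a τ) (τ i) - bpt a i) :=
      fun i x hx => by rw [hTt i x hx]; ring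
    have hinj : InjOn Tt (Ioc 0 1) := injOn_of_piecewise_translation hF
      (fun x hx => ⟨It x 0, by simpa [hPt.1 x hx] using (hIt x hx 0 _).1 rfl⟩)
      (fun i j h => disjoint_Jtil ha0 h) (fun i x hx => hTt.mem_Jtil_aperm hx)
    have hper : ∀ x ∈ Ioc (0 : ℝ) 1, ∀ k : ℕ, 1 ≤ k → Tt^[k] x ≠ x := fun x hx k hk =>
      dual_aperiodic hT hTt hnoper hx (fun m => by
        have h := iterate_zIter hPt.2 hx 0 m
        rw [hPt.1 x hx] at h
        exact ⟨It x (0 + m), h ▸ (hIt x hx _ _).1 rfl⟩) hk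
    have hJ : ∀ i, (Jtil a i).OrdConnected := fun i => ordConnected_Ioc
    exact fun x hx y hy hxy =>
      ⟨not_posAsymp_of_aperiodic hF hJ Ioc_subset_Icc_self hinj hPt.1 hPt.2 hIt hper hx hy hxy,
        not_negAsymp_of_aperiodic hF hJ (Jtil_subset ha) Ioc_subset_Icc_self hinj hPt.1 hPt.2 hIt
          hper hx hy hxy⟩
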